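/- arXiv:2305.14191 — 9 statements merged into one kernel-verified Lean document; each statement's English description precedes it below -/
import Mathlib

section
/- Let A_1, ..., A_m and B_1, ..., B_m be finite sets such that A_i ∩ B_i = ∅ for each 1 ≤ i ≤ m, and A_i ∩ B_j ≠ ∅ for each i ≠ j (1 ≤ i, j ≤ m). Then ∑_{i=1}^m 1 / binomial(|A_i| + |B_i|, |A_i|) ≤ 1. -/
/-- Removing one element from a `b`-set with `b ≠ 0` scales `1 / C(a + b, a)` by `1 + a / b`. -/
theorem one_div_choose_add_pred (a b : ℕ) (hb : b ≠ 0) :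
    (1 : ℚ) / ((a + (b - 1)).choose a) = 1 / ((a + b).choose a) * (1 + a / b) := by
  obtain ⟨b, rfl⟩ := Nat.exists_eq_succ_of_ne_zero hb
  have h := Nat.choose_mul_succ_eq (a + b) a
  rw [show a + b + 1 - a = b + 1 by omega] at h
  have h' : ((a + b).choose a : ℚ) * (a + b + 1) = (a + (b + 1)).choose a * (b + 1) := by
    exact_mod_cast h
  have h₁ : ((a + b).choose a : ℚ) ≠ 0 :=
    Nat.cast_ne_zero.2 (Nat.choose_pos (by omega)).ne'
  have h₂ : ((a + (b + 1)).choose a : ℚ) ≠ 0 :=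
    Nat.cast_ne_zero.2 (Nat.choose_pos (by omega)).ne'
  have h₃ : (b : ℚ) + 1 ≠ 0 := by positivity
  simp only [Nat.succ_eq_add_one, Nat.add_sub_cancel, Nat.cast_add, Nat.cast_one]
  field_simp
  linarith

/-- Averaging the weight `1 / C(|A| + |B \ {x}|, |A|)` over the points `x ∉ A` of a ground set. -/
theorem sum_one_div_choose_erase {α : Type*} [DecidableEq α] {X A B : Finset α}
    (hA : A ⊆ X) (hB : B ⊆ X) (hAB : Disjoint A B) (hne : B.Nonempty) :
    ∑ x ∈ X, (if x ∉ A then (1 : ℚ) / ((A.card + (B.erase x).card).choose A.card) else 0) =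
      X.card * (1 / ((A.card + B.card).choose A.card)) := by
  have hb : (B.card : ℚ) ≠ 0 := Nat.cast_ne_zero.2 hne.card_ne_zero
  calc
    _ = ∑ x ∈ X, (1 : ℚ) / ((A.card + B.card).choose A.card) *
          (1 - (if x ∈ A then 1 else 0) + (if x ∈ B then (A.card : ℚ) / B.card else 0)) := by
      refine Finset.sum_congr rfl fun x _ => ?_
      by_cases hxA : x ∈ A
      · simp [hxA, Finset.disjoint_left.1 hAB hxA]
      · by_cases hxB : x ∈ B
        · simp only [hxA, hxB, not_false_eq_true, if_true, if_false, sub_zero,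
            Finset.card_erase_of_mem]
          exact one_div_choose_add_pred _ _ hne.card_ne_zero
        · simp [hxA, hxB]
    _ = _ := by
      rw [← Finset.mul_sum, Finset.sum_add_distrib, Finset.sum_sub_distrib, Finset.sum_ite_mem,
        Finset.sum_ite_mem, Finset.inter_eq_right.2 hA, Finset.inter_eq_right.2 hB]
      simp only [Finset.sum_const, nsmul_eq_mul, mul_one]
      rw [mul_div_cancel₀ _ hb]
      ring

/-- Bollobás' inequality for families of subsets of a finite ground set. -/
theorem sum_one_div_choose_le_one {ι α : Type*} [DecidableEq α] (X : Finset α) (s : Finset ι)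
    (A B : ι → Finset α) (hA : ∀ i ∈ s, A i ⊆ X) (hB : ∀ i ∈ s, B i ⊆ X)
    (hdisj : ∀ i ∈ s, Disjoint (A i) (B i))
    (hmeet : ∀ i ∈ s, ∀ j ∈ s, i ≠ j → ¬ Disjoint (A i) (B j)) :
    ∑ i ∈ s, (1 : ℚ) / (((A i).card + (B i).card).choose (A i).card) ≤ 1 := by
  induction X using Finset.strongInduction generalizing s B with
  | H X ih =>
  by_cases hempty : ∃ i ∈ s, B i = ∅
  · obtain ⟨i, hi, hBi⟩ := hempty
    have hs : s = {i} := Finset.eq_singleton_iff_unique_mem.2 ⟨hi, fun j hj => by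
      by_contra hji
      exact hmeet j hj i hi hji (by simp [hBi])⟩
    simp [hs, hBi]
  push Not at hempty
  obtain rfl | ⟨i₀, hi₀⟩ := s.eq_empty_or_nonempty
  · simp
  have hX : (0 : ℚ) < X.card :=
    Nat.cast_pos.2 ((hempty i₀ hi₀).mono (hB i₀ hi₀)).card_pos
  refine le_of_mul_le_mul_left ?_ hX
  calc
    _ = ∑ i ∈ s, ∑ x ∈ X, (if x ∉ A i then
          (1 : ℚ) / (((A i).card + ((B i).erase x).card).choose (A i).card) else 0) := by
      rw [Finset.mul_sum]
      exact Finset.sum_congr rfl fun i hi =>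
        (sum_one_div_choose_erase (hA i hi) (hB i hi) (hdisj i hi) (hempty i hi)).symm
    _ = ∑ x ∈ X, ∑ i ∈ s with x ∉ A i,
          (1 : ℚ) / (((A i).card + ((B i).erase x).card).choose (A i).card) := by
      rw [Finset.sum_comm]
      simp only [Finset.sum_filter]
    _ ≤ ∑ x ∈ X, 1 := by
      refine Finset.sum_le_sum fun x hx => ?_
      refine ih (X.erase x) (Finset.erase_ssubset hx) _ (fun i => (B i).erase x) ?_ ?_ ?_ ?_
      · intro i hi
        rw [Finset.mem_filter] at hi
        exact Finset.subset_erase.2 ⟨hA i hi.1, hi.2⟩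
      · intro i hi
        exact Finset.erase_subset_erase x (hB i (Finset.mem_filter.1 hi).1)
      · intro i hi
        exact (hdisj i (Finset.mem_filter.1 hi).1).mono_right (Finset.erase_subset _ _)
      · intro i hi j hj hij
        rw [Finset.mem_filter] at hi hj
        obtain ⟨y, hyA, hyB⟩ := Finset.not_disjoint_iff.1 (hmeet i hi.1 j hj.1 hij)
        exact Finset.not_disjoint_iff.2
          ⟨y, hyA, Finset.mem_erase.2 ⟨ne_of_mem_of_not_mem hyA hi.2, hyB⟩⟩
    _ = _ := by simp

/-- Bollobás' Theorem: if `A i ∩ B i = ∅` for all `i` and `A i ∩ B j ≠ ∅` for all `i ≠ j`,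
then `∑ i, 1 / C(|A i| + |B i|, |A i|) ≤ 1`. -/
theorem bollobas (m : ℕ) (A B : Fin m → Finset ℕ)
    (hdisj : ∀ i, A i ∩ B i = ∅)
    (hmeet : ∀ i j, i ≠ j → A i ∩ B j ≠ ∅) :
    ∑ i, (1 : ℚ) / (((A i).card + (B i).card).choose (A i).card) ≤ 1 := by
  have hsub (i : Fin m) : A i ∪ B i ⊆ Finset.univ.biUnion fun j => A j ∪ B j :=
    Finset.subset_biUnion_of_mem (fun j => A j ∪ B j) (Finset.mem_univ i)
  exact sum_one_div_choose_le_one _ Finset.univ A B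
    (fun i _ => Finset.subset_union_left.trans (hsub i))
    (fun i _ => Finset.subset_union_right.trans (hsub i))
    (fun i _ => Finset.disjoint_iff_inter_eq_empty.2 (hdisj i))
    (fun i _ j _ hij h => hmeet i j hij (Finset.disjoint_iff_inter_eq_empty.1 h))
end

section
/- Let A_1, ..., A_m be r-element finite sets and B_1, ..., B_m be s-element finite sets such that A_i ∩ B_i = ∅ for each 1 ≤ i ≤ m, and A_i ∩ B_j ≠ ∅ for each i ≠ j (1 ≤ i, j ≤ m). Then m ≤ binomial(r + s, s). -/
open Finset in
/-- Averaging identity: deleting from `B` a uniformly random point `x ∈ X`, and discarding the pair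
`(A, B)` when `x ∈ A`, preserves the expected weight `1 / C(|A| + |B|, |B|)`. -/
theorem sum_inv_choose_card_erase {α : Type*} [DecidableEq α] {X A B : Finset α}
    (hA : A ⊆ X) (hB : B ⊆ X) (hAB : Disjoint A B) (hne : B.Nonempty) :
    ∑ x ∈ X with x ∉ A, ((#A + #(B.erase x)).choose #(B.erase x) : ℚ)⁻¹ =
      #X * ((#A + #B).choose #B : ℚ)⁻¹ := by
  have hsplit : X.filter (· ∉ A) = B ∪ X \ (A ∪ B) := by
    ext x
    have := @hB x
    have : x ∈ B → x ∉ A := fun h => disjoint_right.1 hAB h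
    simp only [mem_filter, mem_union, mem_sdiff]
    tauto
  have hdis : Disjoint B (X \ (A ∪ B)) :=
    disjoint_sdiff.mono_left subset_union_right
  have hcard : (#(X \ (A ∪ B)) : ℚ) = #X - (#A + #B) := by
    rw [cast_card_sdiff (union_subset hA hB), card_union_of_disjoint hAB]
    push_cast
    ring
  rw [hsplit, sum_union hdis,
    sum_congr rfl (g := fun _ => ((#A + (#B - 1)).choose (#B - 1) : ℚ)⁻¹)
      fun x hx => by rw [card_erase_of_mem hx],
    sum_congr (s₁ := X \ (A ∪ B)) rfl (g := fun _ => ((#A + #B).choose #B : ℚ)⁻¹)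
      fun x hx => by
        rw [erase_eq_of_notMem fun h => (mem_sdiff.1 hx).2 (mem_union_right _ h)],
    sum_const, sum_const, nsmul_eq_mul, nsmul_eq_mul, hcard]
  obtain ⟨b, hb⟩ : ∃ b, #B = b + 1 := Nat.exists_eq_succ_of_ne_zero hne.card_pos.ne'
  rw [hb, Nat.add_sub_cancel, ← add_assoc]
  have hrec : ((#A + b + 1 : ℕ) : ℚ) * (#A + b).choose b =
      (#A + b + 1).choose (b + 1) * (b + 1 : ℕ) := by
    exact_mod_cast Nat.add_one_mul_choose_eq (#A + b) b
  have h₁ : ((#A + b).choose b : ℚ) ≠ 0 := by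
    exact_mod_cast (Nat.choose_pos (Nat.le_add_left _ _)).ne'
  have h₂ : ((#A + b + 1).choose (b + 1) : ℚ) ≠ 0 := by
    exact_mod_cast (Nat.choose_pos (by omega)).ne'
  field_simp
  push_cast at hrec ⊢
  linear_combination -hrec

open Finset in
/-- Bollobás' set-pair inequality. -/
theorem sum_inv_choose_card_le_one {ι α : Type*} [DecidableEq α] (X : Finset α) (I : Finset ι)
    (A B : ι → Finset α) (hA : ∀ i ∈ I, A i ⊆ X) (hB : ∀ i ∈ I, B i ⊆ X)
    (hdisj : ∀ i ∈ I, Disjoint (A i) (B i))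
    (hmeet : ∀ i ∈ I, ∀ j ∈ I, i ≠ j → ¬ Disjoint (A i) (B j)) :
    ∑ i ∈ I, ((#(A i) + #(B i)).choose #(B i) : ℚ)⁻¹ ≤ 1 := by
  induction hn : #X generalizing X I B with
  | zero =>
    obtain rfl := card_eq_zero.1 hn
    have hI : #I ≤ 1 := card_le_one.2 fun i hi j hj => by
      by_contra hij
      exact hmeet i hi j hj hij (by simp [subset_empty.1 (hB j hj)])
    rw [sum_congr rfl (g := fun _ => (1 : ℚ))
      fun i hi => by simp [subset_empty.1 (hB i hi)]]
    simpa using hI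
  | succ n ih =>
    by_cases hempty : ∃ j ∈ I, B j = ∅
    · obtain ⟨j, hj, hBj⟩ := hempty
      have hI : I = {j} := eq_singleton_iff_unique_mem.2 ⟨hj, fun i hi => by
        by_contra hij
        exact hmeet i hi j hj hij (by simp [hBj])⟩
      simp [hI, hBj]
    push Not at hempty
    have hstep : ∀ x ∈ X, ∑ i ∈ I with x ∉ A i,
        ((#(A i) + #((B i).erase x)).choose #((B i).erase x) : ℚ)⁻¹ ≤ 1 := by
      intro x hx
      refine ih (X.erase x) _ (fun i => (B i).erase x) ?_ ?_ ?_ ?_ ?_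
      · intro i hi
        obtain ⟨hi, hxi⟩ := mem_filter.1 hi
        exact subset_erase.2 ⟨hA i hi, hxi⟩
      · intro i hi
        exact erase_subset_erase x (hB i (mem_filter.1 hi).1)
      · intro i hi
        exact (hdisj i (mem_filter.1 hi).1).mono_right (erase_subset _ _)
      · intro i hi j hj hij h
        obtain ⟨hi, hxi⟩ := mem_filter.1 hi
        refine hmeet i hi j (mem_filter.1 hj).1 hij ?_
        rwa [← disjoint_erase_comm, erase_eq_of_notMem hxi] at h
      · rw [card_erase_of_mem hx, hn, Nat.add_sub_cancel]
    have hsum : (#X : ℚ) * ∑ i ∈ I, ((#(A i) + #(B i)).choose #(B i) : ℚ)⁻¹ ≤ #X := by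
      calc (#X : ℚ) * ∑ i ∈ I, ((#(A i) + #(B i)).choose #(B i) : ℚ)⁻¹
          = ∑ i ∈ I, ∑ x ∈ X with x ∉ A i,
              ((#(A i) + #((B i).erase x)).choose #((B i).erase x) : ℚ)⁻¹ := by
            rw [mul_sum]
            exact sum_congr rfl fun i hi => (sum_inv_choose_card_erase (hA i hi) (hB i hi)
              (hdisj i hi) (hempty i hi)).symm
        _ = ∑ x ∈ X, ∑ i ∈ I with x ∉ A i,
              ((#(A i) + #((B i).erase x)).choose #((B i).erase x) : ℚ)⁻¹ := by
            simp only [sum_filter]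
            exact sum_comm
        _ ≤ ∑ x ∈ X, 1 := sum_le_sum hstep
        _ = #X := by simp
    have hX : (0 : ℚ) < #X := by
      rw [hn]
      positivity
    exact le_of_mul_le_mul_left (by simpa using hsum) hX

/-- Uniform Bollobás' Theorem: if the `A i` are `r`-sets, the `B i` are `s`-sets,
`A i ∩ B i = ∅` for all `i` and `A i ∩ B j ≠ ∅` for all `i ≠ j`, then `m ≤ C(r+s, s)`. -/
theorem bollobas_uniform (m r s : ℕ) (A B : Fin m → Finset ℕ)
    (hA : ∀ i, (A i).card = r) (hB : ∀ i, (B i).card = s)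
    (hdisj : ∀ i, A i ∩ B i = ∅)
    (hmeet : ∀ i j, i ≠ j → A i ∩ B j ≠ ∅) :
    m ≤ (r + s).choose s := by
  have h := sum_inv_choose_card_le_one (Finset.univ.biUnion fun i => A i ∪ B i) Finset.univ A B
    (fun i hi => Finset.subset_union_left.trans
      (Finset.subset_biUnion_of_mem (fun i => A i ∪ B i) hi))
    (fun i hi => Finset.subset_union_right.trans
      (Finset.subset_biUnion_of_mem (fun i => A i ∪ B i) hi))
    (fun i _ => Finset.disjoint_iff_inter_eq_empty.2 (hdisj i))
    (fun i _ j _ hij => fun h => hmeet i j hij (Finset.disjoint_iff_inter_eq_empty.1 h))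
  have hpos : (0 : ℚ) < (r + s).choose s := by
    exact_mod_cast Nat.choose_pos (Nat.le_add_left s r)
  simp only [hA, hB, Finset.sum_const, Finset.card_univ, Fintype.card_fin, nsmul_eq_mul] at h
  rw [← div_eq_mul_inv, div_le_one hpos] at h
  exact_mod_cast h
end

section
/- Let F be an arbitrary field and W a vector space over F. Let U_1, ..., U_m be r-dimensional subspaces and V_1, ..., V_m be s-dimensional subspaces of W. Assume that U_i ∩ V_i = {0} for each 1 ≤ i ≤ m, and U_i ∩ V_j ≠ {0} whenever i < j (1 ≤ i, j ≤ m). Then m ≤ binomial(r + s, r). -/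
/-- The alternating map `x ↦ det (x, v)` obtained from the determinant by fixing the last rows. -/
noncomputable def Matrix.detFixRows {R α β : Type*} [CommRing R] [Fintype α] [hα : DecidableEq α]
    [Fintype β] [DecidableEq β] (v : β → (α ⊕ β → R)) : (α ⊕ β → R) [⋀^α]→ₗ[R] R where
  toFun x := Matrix.detRowAlternating (Sum.elim x v)
  map_update_add' {inst} x i y z := by
    obtain rfl := Subsingleton.elim inst hα
    simp only [← Sum.update_elim_inl]
    exact Matrix.detRowAlternating.map_update_add _ _ _ _
  map_update_smul' {inst} x i c y := by
    obtain rfl := Subsingleton.elim inst hα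
    simp only [← Sum.update_elim_inl]
    exact Matrix.detRowAlternating.map_update_smul _ _ _ _
  map_eq_zero_of_eq' x i j h hij :=
    Matrix.detRowAlternating.map_eq_zero_of_eq _ (i := Sum.inl i) (j := Sum.inl j) (by simpa using h)
      (by simpa using hij)

theorem Matrix.detFixRows_apply {R α β : Type*} [CommRing R] [Fintype α] [DecidableEq α]
    [Fintype β] [DecidableEq β] (v : β → (α ⊕ β → R)) (x : α → (α ⊕ β → R)) :
    Matrix.detFixRows v x = Matrix.det (Matrix.of (Sum.elim x v)) := rfl

/-- A family admitting a triangular dual family with nonzero diagonal is linearly independent. -/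
theorem linearIndependent_of_triangular_dual {R M ι : Type*} [CommRing R] [IsDomain R]
    [AddCommGroup M] [Module R M] [Fintype ι] [LinearOrder ι] (u : ι → M)
    (f : ι → Module.Dual R M) (hdiag : ∀ i, f i (u i) ≠ 0)
    (hlt : ∀ i j, i < j → f j (u i) = 0) : LinearIndependent R u := by
  apply LinearIndependent.of_comp (LinearMap.pi f)
  have hdet : (Matrix.of fun i j => f j (u i)).det ≠ 0 := by
    rw [Matrix.det_of_isLowerTriangular (Matrix.of fun i j => f j (u i))
      (fun i j h => hlt i j h)]
    exact Finset.prod_ne_zero_iff.mpr fun i _ => hdiag i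
  exact Matrix.linearIndependent_rows_of_det_ne_zero hdet

/-- The linear map to `κ`-tuples of polynomials whose matrix in a chosen basis consists of
independent indeterminates. -/
noncomputable def genericMap (F W κ : Type*) [Field F] [AddCommGroup W] [Module F W] :
    W →ₗ[F] κ → MvPolynomial (κ × Module.Basis.ofVectorSpaceIndex F W) F :=
  (Module.Basis.ofVectorSpace F W).constr F fun i k => MvPolynomial.X (k, i)

/-- Every linear map to `κ`-tuples is a specialization of the generic one. -/
theorem exists_aeval_genericMap {F W κ : Type*} [Field F] [AddCommGroup W] [Module F W]
    (g : W →ₗ[F] κ → F) :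
    ∃ e : MvPolynomial (κ × Module.Basis.ofVectorSpaceIndex F W) F →ₐ[F] F,
      ∀ w k, e (genericMap F W κ w k) = g w k := by
  let b := Module.Basis.ofVectorSpace F W
  let e : MvPolynomial (κ × Module.Basis.ofVectorSpaceIndex F W) F →ₐ[F] F :=
    MvPolynomial.aeval fun p => g (b p.2) p.1
  refine ⟨e, fun w k => ?_⟩
  have h : e.toLinearMap ∘ₗ LinearMap.proj k ∘ₗ genericMap F W κ = LinearMap.proj k ∘ₗ g := by
    refine b.ext fun i => ?_
    have hb : genericMap F W κ (b i) = fun k => MvPolynomial.X (k, i) :=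
      b.constr_basis F _ i
    simp only [LinearMap.comp_apply, LinearMap.proj_apply, AlgHom.toLinearMap_apply, hb, e,
      MvPolynomial.aeval_X]
  exact LinearMap.congr_fun h w

theorem det_genericMap_ne_zero {F W κ : Type*} [Field F] [AddCommGroup W] [Module F W]
    [Fintype κ] [DecidableEq κ] {c : κ → W} (hc : LinearIndependent F c) :
    (Matrix.of fun k => genericMap F W κ (c k)).det ≠ 0 := by
  obtain ⟨g, hg⟩ : ∃ g : W →ₗ[F] κ → F, ∀ k, g (c k) = Pi.single k 1 := by
    obtain ⟨g, hg⟩ := LinearMap.exists_leftInverse_of_injective _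
      (linearIndependent_iff_ker.mp hc)
    refine ⟨(Finsupp.linearEquivFunOnFinite F F κ).toLinearMap ∘ₗ g, fun k => ?_⟩
    have h : g (c k) = Finsupp.single k 1 := by
      simpa using LinearMap.congr_fun hg (Finsupp.single k 1)
    simp [h]
  obtain ⟨e, he⟩ := exists_aeval_genericMap g
  intro h
  have h1 : e (Matrix.of fun k => genericMap F W κ (c k)).det = 1 := by
    rw [AlgHom.map_det]
    convert Matrix.det_one (n := κ) (R := F)
    ext k l
    simp [he, hg, Matrix.one_apply, Pi.single_apply, eq_comm]
  simp [h] at h1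

theorem det_genericMap_eq_zero {F W κ : Type*} [Field F] [AddCommGroup W] [Module F W]
    [Fintype κ] [DecidableEq κ] {c : κ → W} (hc : ¬ LinearIndependent F c) :
    (Matrix.of fun k => genericMap F W κ (c k)).det = 0 := by
  obtain ⟨a, ha, k, hk⟩ := Fintype.not_linearIndependent_iff.mp hc
  refine Matrix.exists_vecMul_eq_zero_iff.mp ⟨fun k => MvPolynomial.C (a k), ?_, ?_⟩
  · intro h
    exact hk (by simpa using congr_fun h k)
  · ext1 l
    have h := congr_fun (congr_arg (genericMap F W κ) ha) l
    simpa [Matrix.vecMul, dotProduct, MvPolynomial.smul_eq_C_mul] using h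

/-- Concatenated bases of two subspaces are independent exactly when the subspaces are disjoint. -/
theorem linearIndependent_sumElim_basis_iff {F W α β : Type*} [Field F] [AddCommGroup W]
    [Module F W] {U V : Submodule F W} (bU : Module.Basis α F U) (bV : Module.Basis β F V) :
    LinearIndependent F (Sum.elim (fun i => (bU i : W)) fun j => (bV j : W)) ↔ U ⊓ V = ⊥ := by
  have hU : Submodule.span F (Set.range fun i => (bU i : W)) = U := by
    have := congr_arg (Submodule.map U.subtype) bU.span_eq
    rwa [Submodule.map_span, ← Set.range_comp, Submodule.map_top, Submodule.range_subtype] at this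
  have hV : Submodule.span F (Set.range fun j => (bV j : W)) = V := by
    have := congr_arg (Submodule.map V.subtype) bV.span_eq
    rwa [Submodule.map_span, ← Set.range_comp, Submodule.map_top, Submodule.range_subtype] at this
  rw [linearIndependent_sum]
  simp only [Sum.elim_comp_inl, Sum.elim_comp_inr, hU, hV, disjoint_iff]
  exact ⟨fun h => h.2.2, fun h => ⟨bU.linearIndependent.map' U.subtype U.ker_subtype,
    bV.linearIndependent.map' V.subtype V.ker_subtype, h⟩⟩


/-- Lovász' skew version of Bollobás' Theorem for subspaces. -/
theorem lovasz_skew_bollobas_subspaces (F : Type*) [Field F] (W : Type*) [AddCommGroup W]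
    [Module F W] (m r s : ℕ) (U V : Fin m → Submodule F W)
    (hUfin : ∀ i, FiniteDimensional F (U i)) (hVfin : ∀ i, FiniteDimensional F (V i))
    (hU : ∀ i, Module.finrank F (U i) = r) (hV : ∀ i, Module.finrank F (V i) = s)
    (hdisj : ∀ i, U i ⊓ V i = ⊥)
    (hmeet : ∀ i j, i < j → U i ⊓ V j ≠ ⊥) :
    m ≤ (r + s).choose r := by
  let φ := genericMap F W (Fin r ⊕ Fin s)
  let bU := fun i => Module.finBasisOfFinrankEq F (U i) (hU i)
  let bV := fun i => Module.finBasisOfFinrankEq F (V i) (hV i)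
  let R := MvPolynomial ((Fin r ⊕ Fin s) × Module.Basis.ofVectorSpaceIndex F W) F
  let u : Fin m → ⋀[R]^r (Fin r ⊕ Fin s → R) := fun i =>
    exteriorPower.ιMulti R r fun k => φ (bU i k)
  let f : Fin m → Module.Dual R (⋀[R]^r (Fin r ⊕ Fin s → R)) := fun j =>
    exteriorPower.alternatingMapLinearEquiv (Matrix.detFixRows fun k => φ (bV j k))
  have hf : ∀ i j, f j (u i) = (Matrix.of fun k => φ
      (Sum.elim (fun k => (bU i k : W)) (fun k => (bV j k : W)) k)).det := by
    intro i j
    simp only [f, u, exteriorPower.alternatingMapLinearEquiv_apply_ιMulti,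
      Matrix.detFixRows_apply]
    congr 2
    ext1 (k | k) <;> rfl
  have hind : LinearIndependent R u := by
    refine linearIndependent_of_triangular_dual u f (fun i => ?_) fun i j hij => ?_
    · rw [hf]
      exact det_genericMap_ne_zero
        ((linearIndependent_sumElim_basis_iff (bU i) (bV i)).mpr (hdisj i))
    · rw [hf]
      exact det_genericMap_eq_zero fun h =>
        hmeet i j hij ((linearIndependent_sumElim_basis_iff (bU i) (bV j)).mp h)
  simpa [exteriorPower.finrank_eq] using hind.fintype_card_le_finrank
end

section
/- Let F be an arbitrary field and W an n-dimensional vector space over F. Let U_1, ..., U_m and V_1, ..., V_m be subspaces of W. Assume that U_i ∩ V_i = {0} for each 1 ≤ i ≤ m, and U_i ∩ V_j ≠ {0} whenever i < j (1 ≤ i, j ≤ m). Then m ≤ 2^n. -/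
/-- Over a field, the wedge of a finite family is nonzero iff the family is linearly independent. -/
theorem ExteriorAlgebra.ιMulti_ne_zero_iff {K E : Type*} [Field K] [AddCommGroup E] [Module K E]
    {n : ℕ} (v : Fin n → E) :
    ExteriorAlgebra.ιMulti K n v ≠ 0 ↔ LinearIndependent K v := by
  refine ⟨fun h ↦ ?_, fun h h0 ↦ ?_⟩
  · contrapose! h
    exact AlternatingMap.map_linearDependent _ v h
  · have hli := exteriorPower.ιMulti_family_linearIndependent_field (n := n) h
    let s : Set.powersetCard (Fin n) n := ⟨Finset.univ, by simp⟩
    refine hli.ne_zero s (Subtype.ext ?_)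
    have hid : (Set.powersetCard.ofFinEmbEquiv.symm s : Fin n → Fin n) = id := by
      refine (StrictMono.range_inj (OrderEmbedding.strictMono _) strictMono_id).mp ?_
      rw [Set.range_id, Set.eq_univ_iff_forall]
      exact fun i ↦
        (Set.powersetCard.mem_range_ofFinEmbEquiv_symm_iff_mem s i).mpr (Finset.mem_univ i)
    rw [exteriorPower.ιMulti_family_apply_coe, ExteriorAlgebra.ιMulti_family, hid]
    exact h0

/-- The wedge of a chosen basis of a finite-dimensional subspace. -/
noncomputable def Submodule.blade {K E : Type*} [Field K] [AddCommGroup E] [Module K E]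
    [FiniteDimensional K E] (U : Submodule K E) : ExteriorAlgebra K E :=
  ExteriorAlgebra.ιMulti K (Module.finrank K U) (fun i ↦ (Module.finBasis K U i : E))

theorem Submodule.blade_mul_blade_ne_zero_iff {K E : Type*} [Field K] [AddCommGroup E]
    [Module K E] [FiniteDimensional K E] (U V : Submodule K E) :
    U.blade * V.blade ≠ 0 ↔ Disjoint U V := by
  have hli (S : Submodule K E) :
      LinearIndependent K (fun i ↦ (Module.finBasis K S i : E)) :=
    (Module.finBasis K S).linearIndependent.map' S.subtype S.ker_subtype
  have hspan (S : Submodule K E) :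
      Submodule.span K (Set.range fun i ↦ (Module.finBasis K S i : E)) = S := by
    have h := congrArg (Submodule.map S.subtype) (Module.finBasis K S).span_eq
    rwa [Submodule.map_span, ← Set.range_comp, Submodule.map_subtype_top] at h
  have happend {p q : ℕ} (a : Fin p → E) (b : Fin q → E) :
      Fin.append a b ∘ finSumFinEquiv = Sum.elim a b := by
    ext (i | i) <;> simp
  rw [Submodule.blade, Submodule.blade, ExteriorAlgebra.ιMulti_mul_ιMulti,
    ExteriorAlgebra.ιMulti_ne_zero_iff, ← linearIndependent_equiv finSumFinEquiv,
    happend, linearIndependent_sum]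
  simp only [Sum.elim_comp_inl, Sum.elim_comp_inr, hspan, hli, true_and]

theorem ExteriorAlgebra.finrank_eq {K E : Type*} [Field K] [AddCommGroup E] [Module K E]
    [FiniteDimensional K E] :
    Module.finrank K (ExteriorAlgebra K E) = 2 ^ Module.finrank K E := by
  rw [Module.finrank_eq_card_basis (Module.finBasis K E).ExteriorAlgebra]
  simp

/-- Vectors `v j` in an algebra are linearly independent if some `u i` pair with them in a
triangular way. -/
theorem linearIndependent_of_mul_eq_zero_of_lt {K A ι : Type*} [Field K] [Ring A] [Algebra K A]
    [Fintype ι] [LinearOrder ι] (u v : ι → A)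
    (hne : ∀ i, u i * v i ≠ 0) (hzero : ∀ i j, i < j → u i * v j = 0) :
    LinearIndependent K v := by
  rw [Fintype.linearIndependent_iff]
  intro c hc i
  induction i using WellFoundedLT.induction with
  | ind i ih =>
    have h := congrArg (u i * ·) hc
    simp only [Finset.mul_sum, mul_zero, mul_smul_comm] at h
    rw [Finset.sum_eq_single i] at h
    · exact (smul_eq_zero.mp h).resolve_right (hne i)
    · intro j _ hj
      rcases hj.lt_or_gt with hlt | hgt
      · rw [ih j hlt, zero_smul]
      · rw [hzero i j hgt, smul_zero]
    · simp

/-- Non-uniform skew subspace version of Bollobás' Theorem. -/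
theorem skew_bollobas_subspaces_nonuniform (F : Type*) [Field F] (W : Type*) [AddCommGroup W]
    [Module F W] [FiniteDimensional F W] (n m : ℕ) (hn : Module.finrank F W = n)
    (U V : Fin m → Submodule F W)
    (hdisj : ∀ i, U i ⊓ V i = ⊥)
    (hmeet : ∀ i j, i < j → U i ⊓ V j ≠ ⊥) :
    m ≤ 2 ^ n := by
  have hli : LinearIndependent F (fun j ↦ (V j).blade) := by
    refine linearIndependent_of_mul_eq_zero_of_lt (fun i ↦ (U i).blade) _ (fun i ↦ ?_)
      fun i j hij ↦ ?_
    · exact (Submodule.blade_mul_blade_ne_zero_iff _ _).mpr (disjoint_iff.mpr (hdisj i))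
    · by_contra h
      exact hmeet i j hij (disjoint_iff.mp ((Submodule.blade_mul_blade_ne_zero_iff _ _).mp h))
  have : Module.Finite F (ExteriorAlgebra F W) :=
    Module.Finite.of_basis (Module.finBasis F W).ExteriorAlgebra
  simpa [ExteriorAlgebra.finrank_eq, hn] using hli.fintype_card_le_finrank
end

section
/- Let A_1, ..., A_m and B_1, ..., B_m be subsets of [n] = {1, ..., n}. Assume that for some integer t with 0 ≤ t ≤ n, |A_i ∩ B_i| ≤ t for each 1 ≤ i ≤ m, and |A_i ∩ B_j| > t whenever i < j (1 ≤ i, j ≤ m). Then m ≤ 2^(n - t). -/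
open Finset in
/-- A product of `#D` linear forms, evaluated at the points `x i`, is a combination of the monomials
of degree `#D`. -/
theorem prod_linear_forms_mem_span {K ι κ σ : Type*} [Field K] [Fintype σ]
    (x : ι → σ → K) (a : κ → σ → K) (D : Finset κ) :
    (fun i => ∏ k ∈ D, ∑ r, x i r * a k r) ∈
      Submodule.span K (Set.range fun (s : Sym σ #D) (i : ι) => (s.1.map (x i)).prod) := by
  classical
  induction D using Finset.induction_on with
  | empty =>
    refine Submodule.subset_span ⟨⟨0, rfl⟩, ?_⟩
    ext i
    simp
  | insert k D hk ih =>
    have key : ∀ f ∈ Submodule.span K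
        (Set.range fun (s : Sym σ #D) (i : ι) => (s.1.map (x i)).prod),
        (fun i => (∑ r, x i r * a k r) * f i) ∈ Submodule.span K
          (Set.range fun (s : Sym σ #(insert k D)) (i : ι) => (s.1.map (x i)).prod) := by
      intro f hf
      induction hf using Submodule.span_induction with
      | mem f hf =>
        obtain ⟨s, rfl⟩ := hf
        have h : (fun i => (∑ r, x i r * a k r) * (s.1.map (x i)).prod) =
            ∑ r, a k r • fun i => ((r ::ₘ s.1).map (x i)).prod := by
          ext i
          simp only [Finset.sum_apply, Pi.smul_apply, smul_eq_mul, Multiset.map_cons,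
            Multiset.prod_cons, Finset.sum_mul]
          exact Finset.sum_congr rfl fun r _ => by ring
        rw [h]
        refine Submodule.sum_mem _ fun r _ => Submodule.smul_mem _ _ (Submodule.subset_span ?_)
        exact ⟨⟨r ::ₘ s.1, by rw [Multiset.card_cons, s.2, card_insert_of_notMem hk]⟩, rfl⟩
      | zero =>
        convert Submodule.zero_mem _ using 1
        ext i
        simp
      | add f g _ _ hf hg =>
        convert Submodule.add_mem _ hf hg using 1
        ext i
        simp [mul_add]
      | smul c f _ hf =>
        convert Submodule.smul_mem _ c hf using 1
        ext i
        simp [mul_left_comm]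
    simpa only [prod_insert hk] using key _ ih

open Finset in
/-- The skew version of the Bollobás set-pair theorem. -/
theorem skew_bollobas_uniform {ι : Type*} [Fintype ι] [LinearOrder ι] {n p q : ℕ}
    (C D : ι → Finset (Fin n)) (hC : ∀ i, #(C i) = p) (hD : ∀ i, #(D i) = q)
    (hdiag : ∀ i, Disjoint (C i) (D i)) (hskew : ∀ i j, i < j → ¬ Disjoint (C i) (D j)) :
    Fintype.card ι ≤ (p + q).choose q := by
  let P : ι → Polynomial ℚ := fun i => ∏ c ∈ C i, (Polynomial.X - Polynomial.C (c.val : ℚ))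
  let M : Matrix ι ι ℚ := fun j i => ∏ k ∈ D j, (P i).eval (k.val : ℚ)
  have heval : ∀ i (k : Fin n), (P i).eval (k.val : ℚ) = 0 ↔ k ∈ C i := by
    intro i k
    simp only [P, Polynomial.eval_prod, prod_eq_zero_iff, Polynomial.eval_sub, Polynomial.eval_X,
      Polynomial.eval_C, sub_eq_zero, Nat.cast_inj, Fin.val_inj]
    simp
  have hexpand : ∀ i (k : Fin n), (P i).eval (k.val : ℚ) =
      ∑ r : Fin (p + 1), (P i).coeff r * (k.val : ℚ) ^ (r : ℕ) := by
    intro i k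
    have hdeg : (P i).natDegree < p + 1 := by
      simp only [P, Polynomial.natDegree_finsetProd_X_sub_C_eq_card, hC]
      omega
    rw [Polynomial.eval_eq_sum_range' hdeg, Finset.sum_range]
  have hzero : ∀ i j, M j i = 0 ↔ ¬ Disjoint (C i) (D j) := by
    intro i j
    simp only [M, prod_eq_zero_iff, heval, not_disjoint_iff]
    exact exists_congr fun _ => and_comm
  have hdet : M.det ≠ 0 := by
    rw [Matrix.det_of_isUpperTriangular fun j i hij => (hzero i j).2 (hskew i j hij)]
    exact prod_ne_zero_iff.2 fun i _ h => (hzero i i).1 h (hdiag i)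
  have hli : LinearIndependent ℚ M.row := Matrix.linearIndependent_rows_of_det_ne_zero hdet
  have hmem : Submodule.span ℚ (Set.range M.row) ≤ Submodule.span ℚ
      (Set.range fun (s : Sym (Fin (p + 1)) q) (i : ι) =>
        (s.1.map fun r : Fin (p + 1) => (P i).coeff r).prod) := by
    rw [Submodule.span_le]
    rintro _ ⟨j, rfl⟩
    have := prod_linear_forms_mem_span (fun i (r : Fin (p + 1)) => (P i).coeff r)
      (fun (k : Fin n) r => (k.val : ℚ) ^ (r : ℕ)) (D j)
    rw [hD] at this
    simp only [← hexpand] at this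
    exact this
  calc Fintype.card ι = Module.finrank ℚ (Submodule.span ℚ (Set.range M.row)) :=
        (finrank_span_eq_card hli).symm
    _ ≤ _ := Submodule.finrank_mono hmem
    _ ≤ Fintype.card (Sym (Fin (p + 1)) q) := finrank_range_le_card _
    _ = (p + q).choose q := by
        rw [Sym.card_sym_eq_choose, Fintype.card_fin]
        congr 1
        omega

open Finset in
/-- Skew set pairs `(C i, D i)` whose sizes are only required to add up to `d`. -/
theorem skew_bollobas_card_add_card {n m d : ℕ} (C D : Fin m → Finset (Fin n))
    (hcard : ∀ i, #(C i) + #(D i) = d) (hdiag : ∀ i, Disjoint (C i) (D i))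
    (hskew : ∀ i j, i < j → #(C i ∪ D j) < d) : m ≤ 2 ^ d := by
  have hfiber : ∀ p ∈ range (d + 1), #{i | #(C i) = p} ≤ d.choose p := by
    intro p hp
    have hpd : p ≤ d := Nat.lt_succ_iff.1 (mem_range.1 hp)
    have h := skew_bollobas_uniform (ι := {i // #(C i) = p}) (p := p) (q := d - p)
      (fun i => C i) (fun i => D i) (fun i => i.2)
      (fun i => by have := hcard i; have := i.2; omega) (fun i => hdiag i)
      (fun i j hij hdisj => by
        have := hskew i j hij
        rw [card_union_of_disjoint hdisj] at this
        have := hcard j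
        have := i.2
        have := j.2
        omega)
    rwa [Fintype.card_subtype, Nat.add_sub_cancel' hpd, Nat.choose_symm hpd] at h
  calc m = #(univ : Finset (Fin m)) := by simp
    _ = ∑ p ∈ range (d + 1), #{i | #(C i) = p} :=
        card_eq_sum_card_fiberwise fun i _ => by
          have := hcard i
          simp only [coe_range, Set.mem_Iio]
          omega
    _ ≤ ∑ p ∈ range (d + 1), d.choose p := sum_le_sum hfiber
    _ = 2 ^ d := Nat.sum_range_choose d

/-- Non-uniform threshold skew set-pair theorem: subsets of an `n`-element set. -/
theorem threshold_skew_bollobas_sets_nonuniform (n m t : ℕ) (ht : t ≤ n)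
    (A B : Fin m → Finset (Fin n))
    (hdiag : ∀ i, (A i ∩ B i).card ≤ t)
    (hskew : ∀ i j, i < j → t < (A i ∩ B j).card) :
    m ≤ 2 ^ (n - t) := by
  have hcompl : ∀ i j, ((A i)ᶜ ∪ (B j)ᶜ).card = n - (A i ∩ B j).card := fun i j => by
    rw [← Finset.compl_inter, Finset.card_compl, Fintype.card_fin]
  have hsub : ∀ i, ∃ E ⊆ (A i)ᶜ ∪ (B i)ᶜ, E.card = n - t := fun i =>
    Finset.exists_subset_card_eq (by rw [hcompl]; have := hdiag i; omega)
  choose E hE hEcard using hsub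
  refine skew_bollobas_card_add_card (fun i => E i ∩ (A i)ᶜ) (fun i => E i \ (A i)ᶜ)
    (fun i => ?_) (fun i => ?_) (fun i j hij => ?_)
  · rw [Finset.card_inter_add_card_sdiff, hEcard]
  · exact (Finset.disjoint_sdiff_inter _ _).symm
  · have hle : (E i ∩ (A i)ᶜ ∪ E j \ (A j)ᶜ).card ≤ ((A i)ᶜ ∪ (B j)ᶜ).card := by
      refine Finset.card_le_card (Finset.union_subset_union Finset.inter_subset_right ?_)
      intro k hk
      rw [Finset.mem_sdiff] at hk
      exact (Finset.mem_union.1 (hE j hk.1)).resolve_left hk.2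
    have := hskew i j hij
    have hn : (A i ∩ B j).card ≤ n := by simpa using Finset.card_le_univ (A i ∩ B j)
    rw [hcompl] at hle
    omega
end

section
/- Let A_1, ..., A_m and B_1, ..., B_m be subsets of [n] = {1, ..., n} such that A_i ∩ B_i = ∅ for each 1 ≤ i ≤ m, and A_i ∩ B_j ≠ ∅ for each i < j (1 ≤ i, j ≤ m). Then ∑_{i=1}^m 1 / binomial(|A_i| + |B_i|, |A_i|) ≤ n + 1. -/
theorem one_div_choose_le_add (a b : ℕ) :
    (1 : ℚ) / (a + b).choose a ≤
      1 / ((a + 1) + b).choose (a + 1) + 1 / (a + (b + 1)).choose a := by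
  have one_div_choose (c d : ℕ) :
      (1 : ℚ) / (c + d).choose c = c.factorial * d.factorial / (c + d).factorial := by
    have h : ((c + d).choose c * c.factorial * d.factorial : ℚ) = (c + d).factorial := by
      rw [Nat.choose_symm_add]
      exact_mod_cast Nat.add_choose_mul_factorial_mul_factorial c d
    have hpos : ((c + d).choose c : ℚ) ≠ 0 := by
      exact_mod_cast (Nat.choose_pos (Nat.le_add_right c d)).ne'
    have hfac : ((c + d).factorial : ℚ) ≠ 0 := by positivity
    field_simp
    linarith
  rw [one_div_choose, one_div_choose, one_div_choose, show a + 1 + b = a + b + 1 by ring, ← add_assoc, ← add_div,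
    Nat.factorial_succ (a + b), Nat.factorial_succ a, Nat.factorial_succ b,
    div_le_div_iff₀ (by positivity) (by positivity)]
  push_cast
  have h : (0 : ℚ) ≤ a.factorial * b.factorial * (a + b).factorial := by positivity
  linarith

theorem one_div_choose_le_sum_separating {α : Type*} [Fintype α] [DecidableEq α]
    (A B : Finset α) (hAB : Disjoint A B) :
    (1 : ℚ) / (A.card + B.card).choose A.card ≤
      ∑ S : Finset α with A ⊆ S ∧ Disjoint B S, 1 / ((Fintype.card α).choose S.card : ℚ) := by
  induction h : ((A ∪ B)ᶜ).card generalizing A B with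
  | zero =>
    have hun : A ∪ B = Finset.univ := by
      rwa [Finset.card_eq_zero, Finset.compl_eq_empty_iff] at h
    have hcard : A.card + B.card = Fintype.card α := by
      rw [← Finset.card_union_of_disjoint hAB, hun, Finset.card_univ]
    rw [hcard]
    exact Finset.single_le_sum (f := fun S : Finset α => 1 / ((Fintype.card α).choose S.card : ℚ))
      (fun _ _ => by positivity) (by simpa using hAB.symm)
  | succ k ih =>
    obtain ⟨x, hx⟩ : ((A ∪ B)ᶜ).Nonempty := by
      rw [← Finset.card_pos]
      lia
    obtain ⟨hxA, hxB⟩ : x ∉ A ∧ x ∉ B := by simpa using hx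
    have hcompl : (((A ∪ B)ᶜ).erase x).card = k := by
      rw [Finset.card_erase_of_mem hx, h, Nat.add_sub_cancel]
    have hA := ih (insert x A) B (Finset.disjoint_insert_left.mpr ⟨hxB, hAB⟩)
      (by rw [Finset.insert_union, Finset.compl_insert, hcompl])
    have hB := ih A (insert x B) (Finset.disjoint_insert_right.mpr ⟨hxA, hAB⟩)
      (by rw [Finset.union_insert, Finset.compl_insert, hcompl])
    rw [Finset.card_insert_of_notMem hxA] at hA
    rw [Finset.card_insert_of_notMem hxB] at hB
    refine (one_div_choose_le_add _ _).trans ((add_le_add hA hB).trans_eq ?_)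
    symm
    rw [← Finset.sum_filter_add_sum_filter_not (Finset.univ.filter _) (fun S : Finset α => x ∈ S),
      Finset.filter_filter, Finset.filter_filter]
    congr 1 <;> refine Finset.sum_congr (Finset.ext fun S => ?_) fun _ _ => rfl <;>
      simp only [Finset.mem_filter, Finset.insert_subset_iff, Finset.disjoint_insert_left] <;> tauto

theorem sum_one_div_choose_card (α : Type*) [Fintype α] :
    ∑ S : Finset α, 1 / ((Fintype.card α).choose S.card : ℚ) = Fintype.card α + 1 := by
  rw [← Finset.powerset_univ,
    Finset.sum_powerset_apply_card (fun k => 1 / ((Fintype.card α).choose k : ℚ)), Finset.card_univ,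
    Finset.sum_congr rfl (g := fun _ => 1)]
  · simp
  · intro k hk
    have hpos : ((Fintype.card α).choose k : ℚ) ≠ 0 := by
      exact_mod_cast (Nat.choose_pos (Finset.mem_range_succ_iff.mp hk)).ne'
    rw [nsmul_eq_mul, mul_one_div_cancel hpos]

/-- Skew version of Bollobás' Theorem with the bound `n + 1`. -/
theorem skew_bollobas (n m : ℕ) (A B : Fin m → Finset (Fin n))
    (hdisj : ∀ i, A i ∩ B i = ∅)
    (hmeet : ∀ i j, i < j → A i ∩ B j ≠ ∅) :
    ∑ i, (1 : ℚ) / (((A i).card + (B i).card).choose (A i).card) ≤ n + 1 := by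
  have hsep (S : Finset (Fin n)) (i j : Fin m) (hi : A i ⊆ S) (hj : Disjoint (B j) S) :
      ¬ i < j := fun hij =>
    hmeet i j hij (Finset.disjoint_iff_inter_eq_empty.mp (hj.symm.mono_left hi))
  have hpair : ((Finset.univ : Finset (Fin m)) : Set (Fin m)).PairwiseDisjoint
      (fun i => Finset.univ.filter fun S => A i ⊆ S ∧ Disjoint (B i) S) := by
    intro i _ j _ hij
    refine Finset.disjoint_left.mpr fun S hSi hSj => ?_
    simp only [Finset.mem_filter, Finset.mem_univ, true_and] at hSi hSj
    exact hij.lt_or_gt.elim (hsep S i j hSi.1 hSj.2) (hsep S j i hSj.1 hSi.2)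
  calc ∑ i, (1 : ℚ) / (((A i).card + (B i).card).choose (A i).card)
      ≤ ∑ i, ∑ S with A i ⊆ S ∧ Disjoint (B i) S,
          1 / ((Fintype.card (Fin n)).choose S.card : ℚ) :=
        Finset.sum_le_sum fun i _ => one_div_choose_le_sum_separating _ _
          (Finset.disjoint_iff_inter_eq_empty.mpr (hdisj i))
    _ ≤ ∑ S : Finset (Fin n), 1 / ((Fintype.card (Fin n)).choose S.card : ℚ) := by
        rw [← Finset.sum_biUnion hpair]
        exact Finset.sum_le_sum_of_subset_of_nonneg (Finset.subset_univ _)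
          fun _ _ _ => by positivity
    _ = n + 1 := by rw [sum_one_div_choose_card, Fintype.card_fin]
end

section
/- For every n ≥ 1 and every integer t with 0 ≤ t ≤ n, there exist m = 2^(n-t) pairs of subsets A_1, ..., A_m and B_1, ..., B_m of [n] = {1, ..., n} such that |A_i ∩ B_i| ≤ t for each 1 ≤ i ≤ m, and |A_i ∩ B_j| > t whenever i < j (1 ≤ i, j ≤ m). (Namely, set T = {n-t+1, ..., n}, list all subsets A of [n-t] in order of decreasing cardinality, and take the pairs (A ∪ T, [n] \ A).) -/
theorem exists_testBit_of_lt {i j : ℕ} (h : i < j) :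
    ∃ x, j.testBit x = true ∧ i.testBit x = false := by
  by_contra! hsub
  have hand : j &&& i = j := Nat.eq_of_testBit_eq fun x => by
    have := hsub x
    rw [Nat.testBit_and]
    cases hj : j.testBit x <;> simp_all
  have : j &&& i ≤ i := Nat.and_le_right
  omega

theorem Fin.card_filter_sub_le {n t : ℕ} (ht : t ≤ n) :
    (Finset.univ.filter fun x : Fin n => n - t ≤ (x : ℕ)).card = t := by
  have h := Fin.card_filter_val_lt (n := n) (m := n - t)
  have hsum := Finset.card_filter_add_card_filter_not
    (s := (Finset.univ : Finset (Fin n))) (fun x : Fin n => (x : ℕ) < n - t)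
  simp only [not_lt, Finset.card_univ, Fintype.card_fin] at hsum
  omega

/-- Sharpness of the bound `m ≤ 2^(n-t)` in the non-uniform threshold skew
set-pair theorem: there exist `2^(n-t)` pairs of subsets of `[n]` satisfying
the threshold conditions. -/
theorem threshold_skew_sharp (n t : ℕ) (hn : 1 ≤ n) (ht : t ≤ n) :
    ∃ A B : Fin (2 ^ (n - t)) → Finset (Fin n),
      (∀ i, (A i ∩ B i).card ≤ t) ∧
      (∀ i j, i < j → t < (A i ∩ B j).card) := by
  refine ⟨fun i => Finset.univ.filter fun x => (x : ℕ) < n - t → (i : ℕ).testBit x = false,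
    fun i => Finset.univ.filter fun x => (x : ℕ) < n - t → (i : ℕ).testBit x = true,
    fun i => ?_, fun i j hij => ?_⟩
  · refine (Finset.card_le_card fun x hx => ?_).trans (Fin.card_filter_sub_le ht).le
    simp only [Finset.mem_inter, Finset.mem_filter, Finset.mem_univ, true_and] at hx ⊢
    by_contra! hlt
    simp [hx.1 hlt] at hx
    omega
  · obtain ⟨x, hxj, hxi⟩ := exists_testBit_of_lt (Fin.lt_def.mp hij)
    have hx : x < n - t := by
      by_contra! hle
      have := Nat.testBit_lt_two_pow (j.isLt.trans_le (Nat.pow_le_pow_right two_pos hle))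
      simp_all
    refine (Fin.card_filter_sub_le ht).symm.trans_lt <| Finset.card_lt_card <|
      (Finset.ssubset_iff_of_subset fun y hy => ?_).mpr ?_
    · simp only [Finset.mem_inter, Finset.mem_filter, Finset.mem_univ, true_and] at hy ⊢
      constructor <;> intro <;> omega
    · refine ⟨⟨x, by omega⟩, ?_, ?_⟩
      · simp [hxi, hxj]
      · simpa only [Finset.mem_filter, Finset.mem_univ, true_and, not_le] using hx
end

section
/- For every n ≥ 1, there exist m = 2^n pairs of subsets A_1, ..., A_m and B_1, ..., B_m of [n] = {1, ..., n} such that A_i ∩ B_i = ∅ for each 1 ≤ i ≤ m, A_i ∩ B_j ≠ ∅ for each i < j (1 ≤ i, j ≤ m), and ∑_{i=1}^m 1 / binomial(|A_i| + |B_i|, |A_i|) = n + 1. (Namely, list all pairs (A, [n] \ A) with A ⊆ [n], sorted by decreasing cardinality of A.) -/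
/-- The finite subsets of a fintype with `n` elements, weighted by the inverse of the number of
sets of the same size, have total weight `n + 1`. -/
theorem sum_inv_choose_card (α : Type*) [Fintype α] :
    ∑ s : Finset α, (1 : ℚ) / ((Fintype.card α).choose s.card) = Fintype.card α + 1 := by
  have h := Finset.sum_powerset_apply_card
    (fun k => (1 : ℚ) / ((Fintype.card α).choose k)) (x := (Finset.univ : Finset α))
  rw [Finset.powerset_univ, Finset.card_univ] at h
  rw [h, Finset.sum_congr rfl (g := fun _ => (1 : ℚ))]
  · simp
  · intro k hk
    have : ((Fintype.card α).choose k : ℚ) ≠ 0 := by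
      exact_mod_cast (Nat.choose_pos (Finset.mem_range_succ_iff.mp hk)).ne'
    rw [nsmul_eq_mul, mul_one_div_cancel this]

/-- The subsets of `Fin n` can be listed by decreasing cardinality. -/
theorem exists_equiv_finset_antitone_card (n : ℕ) :
    ∃ e : Fin (2 ^ n) ≃ Finset (Fin n), Antitone fun i => (e i).card := by
  let e : Fin (2 ^ n) ≃ Finset (Fin n) := (Fintype.equivFinOfCardEq (by simp)).symm
  let f : Fin (2 ^ n) → ℕᵒᵈ := fun i => OrderDual.toDual (e i).card
  exact ⟨(Tuple.sort f).trans e, fun _ _ hij => Tuple.monotone_sort f hij⟩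

/-- The Babai–Frankl example: sharpness of the bound `n + 1` in the skew version
of Bollobás' Theorem. -/
theorem skew_bollobas_sharp (n : ℕ) (hn : 1 ≤ n) :
    ∃ A B : Fin (2 ^ n) → Finset (Fin n),
      (∀ i, A i ∩ B i = ∅) ∧
      (∀ i j, i < j → A i ∩ B j ≠ ∅) ∧
      ∑ i, (1 : ℚ) / (((A i).card + (B i).card).choose (A i).card) = n + 1 := by
  obtain ⟨e, he⟩ := exists_equiv_finset_antitone_card n
  refine ⟨e, fun i => (e i)ᶜ, fun i => Finset.inter_compl _, fun i j hij h => ?_, ?_⟩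
  · have hsub : e i ⊆ e j := by
      rwa [← Finset.disjoint_iff_inter_eq_empty, disjoint_compl_right_iff] at h
    exact hij.ne (e.injective (Finset.eq_of_subset_of_card_le hsub (he hij.le)))
  · simp only [Finset.card_add_card_compl]
    rw [e.sum_comp fun s => (1 : ℚ) / ((Fintype.card (Fin n)).choose s.card),
      sum_inv_choose_card, Fintype.card_fin]
end

section
/- Let F be an infinite field, V an n-dimensional vector space over F, and let k ≤ n with t = n - k. Let W_1, ..., W_m be subspaces of V with dim(W_i) < n for each i. Then there exists a k-dimensional subspace V' of V such that dim(W_i ∩ V') = max(dim(W_i) - t, 0) for each 1 ≤ i ≤ m. -/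
/-- Over an infinite field, for every `j ≤ dim V` there is a `j`-dimensional subspace whose sum
with each member of a given finite family of subspaces has the largest dimension possible. -/
theorem Submodule.exists_finrank_eq_and_finrank_sup_eq_min {F V ι : Type*} [Field F] [Infinite F]
    [AddCommGroup V] [Module F V] [FiniteDimensional F V] [Finite ι] (W : ι → Submodule F V)
    (j : ℕ) (hj : j ≤ Module.finrank F V) :
    ∃ U : Submodule F V, Module.finrank F U = j ∧
      ∀ i, Module.finrank F ↥(W i ⊔ U) = min (Module.finrank F (W i) + j) (Module.finrank F V) := by
  induction j with
  | zero =>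
    exact ⟨⊥, finrank_bot F V, fun i ↦ by rw [sup_bot_eq, add_zero, min_eq_left (W i).finrank_le]⟩
  | succ j ih =>
    obtain ⟨U, hU, hWU⟩ := ih (by omega)
    have hU_top : U ≠ ⊤ := by
      rintro rfl
      rw [finrank_top] at hU
      omega
    let p : Option {i // W i ⊔ U ≠ ⊤} → Submodule F V := fun o ↦ o.elim U fun i ↦ W i ⊔ U
    obtain ⟨v, hv⟩ := Submodule.exists_forall_notMem_of_forall_ne_top p
      (by rintro (_ | i); exacts [hU_top, i.2])
    have hvU : v ∉ U := hv none
    refine ⟨U ⊔ F ∙ v, by rw [finrank_sup_span_singleton hvU, hU], fun i ↦ ?_⟩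
    rw [← sup_assoc]
    have hi := hWU i
    by_cases h : W i ⊔ U = ⊤
    · rw [h, finrank_top] at hi
      rw [h, top_sup_eq, finrank_top]
      omega
    · have hlt := Submodule.finrank_lt h
      have hvW : v ∉ W i ⊔ U := hv (some ⟨i, h⟩)
      rw [finrank_sup_span_singleton hvW, hi]
      omega

/-- General position lemma: over an infinite field, given proper subspaces
`W 1, ..., W m` of an `n`-dimensional space `V`, there is a `k`-dimensional
subspace `V'` with `dim(W i ⊓ V') = max (dim (W i) - t) 0`, where `t = n - k`. -/
theorem exists_subspace_general_position (F : Type*) [Field F] [Infinite F]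
    (V : Type*) [AddCommGroup V] [Module F V] [FiniteDimensional F V]
    (n k t m : ℕ) (hn : Module.finrank F V = n) (hk : k ≤ n) (htdef : t = n - k)
    (W : Fin m → Submodule F V) (hW : ∀ i, Module.finrank F (W i) < n) :
    ∃ V' : Submodule F V, Module.finrank F V' = k ∧
      ∀ i, Module.finrank F ↥(W i ⊓ V') = max (Module.finrank F (W i) - t) 0 := by
  subst hn htdef
  obtain ⟨U, hU, hWU⟩ := Submodule.exists_finrank_eq_and_finrank_sup_eq_min W k hk
  refine ⟨U, hU, fun i ↦ ?_⟩
  have h := Submodule.finrank_sup_add_finrank_inf_eq (W i) U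
  rw [hWU i] at h
  omega
end
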